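/- Let A ⊆ ℕ satisfy BD(A) > 0. Then there exist an integer k ∈ ℤ and strictly increasing sequences (b_i)_{i∈ℕ} and (c_j)_{j∈ℕ} of natural numbers such that for all i, j: if i ≤ j then b_i + c_j ∈ A, and if i > j then b_i + c_j ∈ A + k (the translate A + k being computed in ℤ). -/

import Mathlib

/-- The (upper) Banach density of a set `A ⊆ ℕ`:
`BD(A) = lim_{n→∞} sup_{m∈ℕ} |A ∩ [m, m+n]| / n`. -/
noncomputable def banachDensity (A : Set ℕ) : ℝ :=
  Filter.atTop.limsup fun n : ℕ =>
    ⨆ m : ℕ, (Nat.card ↥(A ∩ Set.Icc m (m + n)) : ℝ) / n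

open Filter Topology MeasureTheory

theorem seq_of_filters (p q : Filter ℕ) [p.NeBot] [q.NeBot] (hp : p ≤ atTop) (hq : q ≤ atTop)
    (P R : ℕ → ℕ → Prop) (h1 : ∀ᶠ b in p, ∀ᶠ c in q, P b c) (h2 : ∀ᶠ c in q, ∀ᶠ b in p, R b c) :
    ∃ b c : ℕ → ℕ, StrictMono b ∧ StrictMono c ∧
      ∀ i j : ℕ, (i ≤ j → P (b i) (c j)) ∧ (i > j → R (b i) (c j)) := by
  obtain ⟨f, hf1, hf2⟩ := exists_seq_of_forall_finset_exists
    (fun x : ℕ × ℕ => (∀ᶠ c in q, P x.1 c) ∧ (∀ᶠ b in p, R b x.2) ∧ P x.1 x.2)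
    (fun x y => x.1 < y.1 ∧ x.2 < y.2 ∧ P x.1 y.2 ∧ R y.1 x.2) (by
      intro s hs
      have hb : ∀ᶠ b in p, ∀ x ∈ s, x.1 < b ∧ R b x.2 := by
        rw [Filter.eventually_all_finset]
        intro x hx
        exact ((eventually_gt_atTop x.1).filter_mono hp).and (hs x hx).2.1
      have hc : ∀ᶠ c in q, ∀ x ∈ s, x.2 < c ∧ P x.1 c := by
        rw [Filter.eventually_all_finset]
        intro x hx
        exact ((eventually_gt_atTop x.2).filter_mono hq).and (hs x hx).1
      obtain ⟨b, hb1, hb2⟩ := (hb.and h1).exists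
      obtain ⟨c, ⟨hc1, hc2⟩, hc3⟩ := ((hc.and h2).and hb2).exists
      exact ⟨(b, c), ⟨hb2, hc2, hc3⟩, fun x hx => ⟨(hb1 x hx).1, (hc1 x hx).1, (hc1 x hx).2, (hb1 x hx).2⟩⟩)
  refine ⟨fun n => (f n).1, fun n => (f n).2, fun m n h => (hf2 m n h).1,
    fun m n h => (hf2 m n h).2.1, fun i j => ⟨fun h => ?_, fun h => (hf2 j i h).2.2.2⟩⟩
  rcases h.lt_or_eq with h | rfl
  · exact (hf2 i j h).2.2.1
  · exact (hf1 i).2.2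

open Classical in
/-- Limit measure on the space of ultrafilters. -/
theorem exists_limit_measure (F : ℕ → Finset ℕ) (hne : ∀ n, (F n).Nonempty)
    (mU : MeasurableSpace (Ultrafilter ℕ)) (hB : BorelSpace (Ultrafilter ℕ)) :
    ∃ μ : Measure (Ultrafilter ℕ), IsProbabilityMeasure μ ∧ ∀ S : Set ℕ,
      Tendsto (fun n => (((F n).filter (· ∈ S)).card : ENNReal) / (F n).card)
        (hyperfilter ℕ) (𝓝 (μ {u | S ∈ u})) := by
  let ν : ℕ → ProbabilityMeasure (Ultrafilter ℕ) := fun n =>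
    ⟨(PMF.uniformOfFinset (F n) (hne n)).toMeasure.map (pure : ℕ → Ultrafilter ℕ),
      Measure.isProbabilityMeasure_map (measurable_of_countable _).aemeasurable⟩
  let lim := ((hyperfilter ℕ).map ν).lim
  have hlim : Tendsto ν (hyperfilter ℕ) (𝓝 lim) := Ultrafilter.le_nhds_lim _
  refine ⟨lim, inferInstance, fun S => ?_⟩
  have hcl : IsClopen {u : Ultrafilter ℕ | S ∈ u} :=
    ⟨ultrafilter_isClosed_basic S, ultrafilter_isOpen_basic S⟩
  have hcm : MeasurableSet {u : Ultrafilter ℕ | S ∈ u} := hcl.2.measurableSet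
  rw [ProbabilityMeasure.tendsto_iff_forall_lintegral_tendsto] at hlim
  let g : BoundedContinuousFunction (Ultrafilter ℕ) NNReal :=
    BoundedContinuousFunction.mkOfCompact
      ⟨Set.indicator {u | S ∈ u} (fun _ => 1), (continuous_const).indicator (by simp [hcl.frontier_eq])⟩
  have hg : ∀ μ : Measure (Ultrafilter ℕ), ∫⁻ x, (g x : ENNReal) ∂μ = μ {u | S ∈ u} := by
    intro μ
    have : (fun x => (g x : ENNReal)) = Set.indicator {u | S ∈ u} (fun _ => 1) := by
      ext x
      by_cases hx : S ∈ x <;> simp [g, hx, Set.indicator]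
    rw [this, lintegral_indicator hcm]
    simp
  have := hlim g
  simp only [hg] at this
  convert this using 2 with n
  simp only [ν, ProbabilityMeasure.coe_mk]
  rw [Measure.map_apply (measurable_of_countable _) hcm,
    PMF.toMeasure_uniformOfFinset_apply _ _ (MeasurableSet.of_discrete)]
  simp

open Classical in
theorem key_ultrafilter (F : ℕ → Finset ℕ) (hne : ∀ n, (F n).Nonempty)
    (hF : Tendsto (fun n => (F n).card) atTop atTop) (S : ℕ → Set ℕ) (δ : ℝ) (hδ : 0 < δ)
    (h : ∀ j, ∀ᶠ n in atTop, δ * (F n).card ≤ ((F n).filter (· ∈ S j)).card) :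
    ∃ p : Ultrafilter ℕ, (p : Filter ℕ) ≤ atTop ∧ ∃ᶠ j in atTop, S j ∈ p := by
  let mU : MeasurableSpace (Ultrafilter ℕ) := borel _
  have hB : BorelSpace (Ultrafilter ℕ) := ⟨rfl⟩
  obtain ⟨μ, hμ, hlim⟩ := exists_limit_measure F hne mU hB
  have hm : ∀ T : Set ℕ, MeasurableSet {u : Ultrafilter ℕ | T ∈ u} := fun T =>
    (ultrafilter_isOpen_basic T).measurableSet
  have hle : (hyperfilter ℕ : Filter ℕ) ≤ atTop := by
    rw [← Nat.cofinite_eq_atTop]; exact hyperfilter_le_cofinite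
  have hS : ∀ j, ENNReal.ofReal δ ≤ μ {u | S j ∈ u} := by
    intro j
    refine ge_of_tendsto (hlim (S j)) (hle ?_)
    filter_upwards [h j] with n hn
    rw [ENNReal.le_div_iff_mul_le (by left; simpa using (hne n).ne_empty) (by left; simp)]
    rw [← ENNReal.ofReal_natCast, ← ENNReal.ofReal_natCast, ← ENNReal.ofReal_mul hδ.le]
    exact ENNReal.ofReal_le_ofReal hn
  have h0 : ∀ m : ℕ, μ {u | {m} ∈ u} = 0 := by
    intro m
    refine tendsto_nhds_unique (hlim {m}) ?_
    have h2 : Tendsto (fun n => ((F n).card : ENNReal)⁻¹) (hyperfilter ℕ) (𝓝 0) :=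
      (ENNReal.tendsto_inv_nat_nhds_zero.comp hF).mono_left hle
    refine tendsto_of_tendsto_of_tendsto_of_le_of_le tendsto_const_nhds h2 (fun _ => zero_le) ?_
    intro n
    simp only [div_eq_mul_inv]
    have : (((F n).filter (· ∈ ({m} : Set ℕ))).card : ENNReal) ≤ 1 := by
      norm_cast
      refine Finset.card_le_one.2 ?_
      simp only [Finset.mem_filter, Set.mem_singleton_iff]
      rintro a ⟨_, rfl⟩ b ⟨_, rfl⟩; rfl
    calc _ ≤ 1 * ((F n).card : ENNReal)⁻¹ := by
          refine mul_le_mul_left (le_trans (le_of_eq ?_) this) _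
          congr 2
          ext x
          simp only [Finset.mem_filter]
      _ = _ := one_mul _
  let G : ℕ → Set (Ultrafilter ℕ) := fun n => ⋃ j ≥ n, {u | S j ∈ u}
  have hGm : ∀ n, MeasurableSet (G n) := fun n =>
    MeasurableSet.iUnion fun j => MeasurableSet.iUnion fun _ => hm _
  have hanti : Antitone G := by
    intro a b hab x hx
    simp only [G, Set.mem_iUnion] at hx ⊢
    obtain ⟨j, hj, hx⟩ := hx
    exact ⟨j, le_trans hab hj, hx⟩
  have hint : ENNReal.ofReal δ ≤ μ (⋂ n, G n) := by
    refine ge_of_tendsto (tendsto_measure_iInter_atTop (fun n => (hGm n).nullMeasurableSet) hanti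
      ⟨0, measure_ne_top _ _⟩) (Eventually.of_forall fun n => ?_)
    refine (hS n).trans (measure_mono ?_)
    intro x hx
    simp only [G, Set.mem_iUnion]
    exact ⟨n, le_rfl, hx⟩
  have hnull : μ (⋃ m : ℕ, {u | {m} ∈ u}) = 0 := measure_iUnion_null h0
  have hpos : μ ((⋂ n, G n) \ ⋃ m : ℕ, {u | {m} ∈ u}) ≠ 0 := by
    rw [measure_sdiff_null hnull]
    have := ENNReal.ofReal_pos.2 hδ
    exact (lt_of_lt_of_le this hint).ne'
  obtain ⟨p, hp1, hp2⟩ := nonempty_of_measure_ne_zero hpos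
  refine ⟨p, ?_, ?_⟩
  · rw [← Nat.cofinite_eq_atTop, le_cofinite_iff_compl_singleton_mem]
    intro m
    refine Ultrafilter.compl_mem_iff_notMem.2 fun hm => hp2 ?_
    exact Set.mem_iUnion.2 ⟨m, hm⟩
  · rw [frequently_atTop]
    intro n
    have := Set.mem_iInter.1 hp1 n
    simp only [G, Set.mem_iUnion] at this
    obtain ⟨j, hj, hx⟩ := this
    exact ⟨j, hj, hx⟩
open Classical in
/-- Number of elements of `A` in `[m, m+l)`. -/
noncomputable def cnt (A : Set ℕ) (m l : ℕ) : ℕ := ((Finset.Ico m (m + l)).filter (· ∈ A)).card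

theorem cnt_add (A : Set ℕ) (m l l' : ℕ) : cnt A m (l + l') = cnt A m l + cnt A (m + l) l' := by
  classical
  unfold cnt
  rw [← Finset.card_union_of_disjoint, ← Finset.filter_union, ← add_assoc,
    Finset.Ico_union_Ico_eq_Ico (by omega) (by omega)]
  refine Finset.disjoint_filter_filter (Finset.disjoint_left.2 fun x hx hx' => ?_)
  simp only [Finset.mem_Ico] at hx hx'
  omega

theorem cnt_le (A : Set ℕ) (m l : ℕ) : cnt A m l ≤ l := by
  classical
  unfold cnt
  refine (Finset.card_filter_le _ _).trans ?_
  simp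

theorem natCard_eq_cnt (A : Set ℕ) (m n : ℕ) :
    Nat.card ↥(A ∩ Set.Icc m (m + n)) = cnt A m (n + 1) := by
  classical
  unfold cnt
  rw [← Set.ncard_coe_finset, ← Nat.card_coe_set_eq]
  congr 2
  ext x
  simp only [Set.mem_inter_iff, Set.mem_Icc, Finset.coe_filter, Finset.mem_Ico]
  constructor
  · rintro ⟨h, h1, h2⟩; exact ⟨⟨h1, by omega⟩, h⟩
  · rintro ⟨⟨h1, h2⟩, h⟩; exact ⟨h, h1, by omega⟩

/-- Thickening of `A` by less than `W`. -/
def thick (A : Set ℕ) (W : ℕ) : Set ℕ := {x | ∃ a ∈ A, x < a + W ∧ a < x + W}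

theorem cnt_block (A : Set ℕ) (W : ℕ) (κ : ℝ) (hκ : ∀ m, (cnt A m W : ℝ) ≤ κ * W) (m K : ℕ)
    (hκ0 : 0 ≤ κ) : (cnt A m (W * K) : ℝ) ≤ κ * cnt (thick A W) m (W * K) := by
  induction K with
  | zero => simp [cnt]
  | succ K ih =>
    rw [Nat.mul_succ, cnt_add, cnt_add]
    push_cast
    rw [mul_add]
    refine add_le_add ih ?_
    by_cases h : ∃ a ∈ A, m + W * K ≤ a ∧ a < m + W * K + W
    · obtain ⟨a, ha, h1, h2⟩ := h
      have : cnt (thick A W) (m + W * K) W = W := by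
        classical
        unfold cnt
        rw [Finset.filter_true_of_mem]
        · simp
        · intro x hx
          simp only [Finset.mem_Ico] at hx
          exact ⟨a, ha, by omega, by omega⟩
      rw [this]
      exact hκ _
    · have : cnt A (m + W * K) W = 0 := by
        classical
        unfold cnt
        rw [Finset.card_eq_zero, Finset.filter_eq_empty_iff]
        intro x hx hxA
        simp only [Finset.mem_Ico] at hx
        exact h ⟨x, hxA, hx.1, hx.2⟩
      rw [this]
      simp only [Nat.cast_zero]
      positivity

theorem exists_intervals (A : Set ℕ) (hA : 0 < banachDensity A) :
    ∃ α : ℝ, 0 < α ∧ ∀ ε : ℝ, 0 < ε → ∃ W : ℕ, ∀ n0 : ℕ, ∃ m l : ℕ, n0 ≤ l ∧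
      α * l ≤ cnt A m l ∧ (1 - ε) * l ≤ cnt (thick A W) m l := by
  set β := banachDensity A with hβ
  refine ⟨β / 2, by positivity, fun ε hε => ?_⟩
  obtain ⟨t, ht0, ht1, ht2⟩ : ∃ t : ℝ, 0 < t ∧ t ≤ 1 / 10 ∧ t ≤ ε / 10 :=
    ⟨min (1 / 10) (ε / 10), by positivity, min_le_left _ _, min_le_right _ _⟩
  set d : ℕ → ℝ := fun n => ⨆ m : ℕ, (Nat.card ↥(A ∩ Set.Icc m (m + n)) : ℝ) / n with hd
  have hle2 : ∀ n m : ℕ, (Nat.card ↥(A ∩ Set.Icc m (m + n)) : ℝ) / n ≤ 2 := by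
    intro n m
    rw [natCard_eq_cnt]
    rcases Nat.eq_zero_or_pos n with rfl | hn
    · simp
    · rw [div_le_iff₀ (by positivity)]
      have := cnt_le A m (n + 1)
      have h3 : cnt A m (n + 1) ≤ 2 * n := by omega
      exact_mod_cast h3
  have hbdd : ∀ n, BddAbove (Set.range fun m : ℕ => (Nat.card ↥(A ∩ Set.Icc m (m + n)) : ℝ) / n) :=
    fun n => ⟨2, by rintro _ ⟨m, rfl⟩; exact hle2 n m⟩
  have hd2 : ∀ n, d n ≤ 2 := fun n => ciSup_le (hle2 n)
  have hd0 : ∀ n, 0 ≤ d n := fun n => Real.iSup_nonneg fun m => by positivity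
  have hlim : β = limsup d atTop := rfl
  have hB1 : IsBoundedUnder (· ≤ ·) atTop d := isBoundedUnder_of ⟨2, hd2⟩
  have hB2 : IsBoundedUnder (· ≥ ·) atTop d := isBoundedUnder_of ⟨0, hd0⟩
  have e1 : ∀ᶠ n in atTop, d n < β * (1 + t) :=
    eventually_lt_of_limsup_lt (by rw [← hlim]; nlinarith) hB1
  have e2 : ∃ᶠ n in atTop, β * (1 - t) < d n :=
    frequently_lt_of_lt_limsup hB2.isCoboundedUnder_le (by rw [← hlim]; nlinarith)
  obtain ⟨W, hW, hW1⟩ := (e1.and (eventually_ge_atTop 1)).exists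
  have hWpos : (0 : ℝ) < W := by exact_mod_cast hW1
  have hκ : ∀ m, (cnt A m W : ℝ) ≤ β * (1 + t) * W := by
    intro m
    have h1 := (le_ciSup (hbdd W) m).trans hW.le
    rw [natCard_eq_cnt, div_le_iff₀ hWpos, cnt_add] at h1
    push_cast at h1
    have : (0 : ℝ) ≤ cnt A (m + W) 1 := by positivity
    linarith
  refine ⟨W, fun n0 => ?_⟩
  obtain ⟨n, hn, hn1⟩ := (e2.and_eventually (eventually_ge_atTop (max n0 ⌈W / t⌉₊))).exists
  have hn0 : n0 ≤ n := (le_max_left _ _).trans hn1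
  have hWn : (W : ℝ) ≤ t * n := by
    have : (W / t : ℝ) ≤ n := (Nat.le_ceil _).trans (by exact_mod_cast (le_max_right _ _).trans hn1)
    rw [div_le_iff₀ ht0] at this
    linarith
  have hnpos : (0 : ℝ) < n := by
    by_contra hcon
    nlinarith
  obtain ⟨m, hm⟩ := exists_lt_of_lt_ciSup hn
  rw [natCard_eq_cnt, lt_div_iff₀ hnpos] at hm
  set K := n / W + 1 with hK
  have hl1 : n + 1 ≤ W * K := by
    exact Nat.lt_mul_div_succ n hW1
  have hl2 : W * K ≤ n + W := by
    have := Nat.mul_div_le n W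
    rw [hK, mul_add]
    omega
  have hl2' : ((W * K : ℕ) : ℝ) ≤ n + W := by exact_mod_cast hl2
  have hcl : cnt A m (n + 1) ≤ cnt A m (W * K) := by
    obtain ⟨r, hr⟩ := Nat.exists_eq_add_of_le hl1
    rw [hr, cnt_add A m (n + 1) r]
    omega
  have hcl' : (cnt A m (n + 1) : ℝ) ≤ cnt A m (W * K) := by exact_mod_cast hcl
  have hblk := cnt_block A W (β * (1 + t)) hκ m K (by positivity)
  refine ⟨m, W * K, by omega, ?_, ?_⟩
  · have : ((W * K : ℕ) : ℝ) ≤ (1 + t) * n := by linarith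
    have h5 : β / 2 * ((W * K : ℕ) : ℝ) ≤ β / 2 * ((1 + t) * n) := by gcongr
    have h6 : β * n * (1 + t) ≤ β * n * (2 * (1 - t)) := by gcongr; linarith
    nlinarith
  · have hl : ((W * K : ℕ) : ℝ) ≤ (1 + t) * n := by linarith
    set x : ℝ := (cnt (thick A W) m (W * K) : ℝ) with hx
    have h5 : β * ((1 - t) * n) ≤ β * ((1 + t) * x) := by nlinarith
    have h6 : (1 - t) * n ≤ (1 + t) * x := le_of_mul_le_mul_left h5 hA
    have h7 : (1 - ε) * ((W * K : ℕ) : ℝ) ≤ (1 - 3 * t) * ((W * K : ℕ) : ℝ) := by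
      gcongr; linarith
    have h8 : (1 - 3 * t) * ((W * K : ℕ) : ℝ) ≤ (1 - 3 * t) * ((1 + t) * n) :=
      mul_le_mul_of_nonneg_left hl (by linarith)
    refine h7.trans (h8.trans ?_)
    refine le_of_mul_le_mul_left ?_ (by linarith : (0 : ℝ) < 1 + t)
    refine le_trans ?_ h6
    have : (1 + t) * ((1 - 3 * t) * ((1 + t) * n)) = (1 - t - 5 * t ^ 2 - 3 * t ^ 3) * n := by ring
    rw [this]
    refine mul_le_mul_of_nonneg_right ?_ hnpos.le
    nlinarith [sq_nonneg t, pow_pos ht0 3]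

theorem cnt_shift (A : Set ℕ) (m l b : ℕ) : cnt A m l ≤ cnt {c | b + c ∈ A} m l + b := by
  have h1 : cnt {c | b + c ∈ A} m l = cnt A (m + b) l := by
    classical
    unfold cnt
    refine Finset.card_bij (fun x _ => b + x) ?_ ?_ ?_
    · intro x hx
      simp only [Finset.mem_filter, Finset.mem_Ico, Set.mem_ofPred_eq] at hx ⊢
      exact ⟨by omega, hx.2⟩
    · intro x _ y _ h
      omega
    · intro y hy
      simp only [Finset.mem_filter, Finset.mem_Ico, Set.mem_ofPred_eq] at hy
      refine ⟨y - b, ?_, by omega⟩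
      simp only [Finset.mem_filter, Finset.mem_Ico, Set.mem_ofPred_eq]
      refine ⟨by omega, ?_⟩
      rw [Nat.add_sub_cancel' (by omega)]
      exact hy.2
  have h2 := cnt_add A m l b
  have h3 := cnt_add A m b l
  rw [add_comm b l] at h3
  have := cnt_le A m b
  omega

theorem cnt_double (A : Set ℕ) (α : ℝ) (hα : 0 ≤ α) (m l m' l' : ℕ) (hl : 0 < l)
    (h : α * l' ≤ cnt A m' l') :
    α / 2 * l' - (m + l) ≤ cnt {c | α / 2 * l ≤ cnt {b | b + c ∈ A} m l} m' l' := by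
  classical
  set S : Set ℕ := {c | α / 2 * l ≤ cnt {b | b + c ∈ A} m l} with hS
  have hlpos : (0 : ℝ) < l := by exact_mod_cast hl
  have hcomm : ∑ b ∈ Finset.Ico m (m + l), (cnt {c | b + c ∈ A} m' l' : ℝ)
      = ∑ c ∈ Finset.Ico m' (m' + l'), (cnt {b | b + c ∈ A} m l : ℝ) := by
    simp only [cnt, Finset.card_filter, Set.mem_ofPred_eq]
    push_cast
    exact Finset.sum_comm
  have hlow : l * (α * l' - (m + l)) ≤
      ∑ b ∈ Finset.Ico m (m + l), (cnt {c | b + c ∈ A} m' l' : ℝ) := by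
    have := Finset.card_nsmul_le_sum (Finset.Ico m (m + l))
      (fun b => (cnt {c | b + c ∈ A} m' l' : ℝ)) (α * l' - (m + l)) (by
        intro b hb
        simp only [Finset.mem_Ico] at hb
        have h1 : (cnt A m' l' : ℝ) ≤ cnt {c | b + c ∈ A} m' l' + b := by
          exact_mod_cast cnt_shift A m' l' b
        have h2 : (b : ℝ) ≤ m + l := by exact_mod_cast hb.2.le
        linarith)
    simpa using this
  have hup : ∑ c ∈ Finset.Ico m' (m' + l'), (cnt {b | b + c ∈ A} m l : ℝ) ≤
      l * cnt S m' l' + l' * (α / 2 * l) := by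
    calc _ ≤ ∑ c ∈ Finset.Ico m' (m' + l'), ((l : ℝ) * (if c ∈ S then 1 else 0) + α / 2 * l) := by
          refine Finset.sum_le_sum fun c _ => ?_
          by_cases hc : c ∈ S
          · have : (cnt {b | b + c ∈ A} m l : ℝ) ≤ l := by exact_mod_cast cnt_le _ m l
            simp only [hc, if_true]
            have : 0 ≤ α / 2 * l := by positivity
            linarith
          · simp only [hc, if_false]
            simp only [hS, Set.mem_ofPred_eq, not_le] at hc
            linarith
      _ = _ := by
          rw [Finset.sum_add_distrib, ← Finset.mul_sum]
          congr 1
          · rw [cnt, Finset.card_filter]; push_cast; rfl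
          · simp
  have hfin : l * (α * l' - (m + l)) ≤ l * (cnt S m' l' + l' * (α / 2)) := by
    rw [← hcomm] at hup
    refine (hlow.trans hup).trans (le_of_eq ?_)
    ring
  have := le_of_mul_le_mul_left hfin hlpos
  linarith

theorem one_shift_structured (A : Set ℕ) (hA : 0 < banachDensity A) :
    ∃ k : ℤ, ∃ b c : ℕ → ℕ, StrictMono b ∧ StrictMono c ∧
      ∀ i j : ℕ,
        (i ≤ j → b i + c j ∈ A) ∧
        (i > j → ((b i : ℤ) + (c j : ℤ)) ∈ (fun a : ℕ => (a : ℤ) + k) '' A) := by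
  classical
  obtain ⟨α, hα, hint⟩ := exists_intervals A hA
  obtain ⟨W, hW⟩ := hint (α / 8) (by positivity)
  choose m l hl hl1 hl2 using fun n : ℕ => hW (n + 1)
  have hlpos : ∀ n, 0 < l n := fun n => by have := hl n; omega
  have hltend : Tendsto l atTop atTop :=
    tendsto_atTop_mono (fun n => (by have := hl n; omega : n ≤ l n)) tendsto_id
  have hltendR : Tendsto (fun n => (l n : ℝ)) atTop atTop :=
    tendsto_natCast_atTop_atTop.comp hltend
  -- first ultrafilter
  obtain ⟨q, hq, hqS⟩ := key_ultrafilter (fun n => Finset.Ico (m n) (m n + l n))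
    (fun n => by simpa using hlpos n) (by simpa using hltend)
    (fun N => {c | α / 2 * l N ≤ cnt {b | b + c ∈ A} (m N) (l N)}) (α / 4) (by positivity) (by
      intro N
      filter_upwards [hltendR.eventually_ge_atTop (4 / α * (m N + l N))] with M hM
      have h1 := cnt_double A α hα.le (m N) (l N) (m M) (l M) (hlpos N) (hl1 M)
      have h2 : (m N + l N : ℝ) ≤ α / 4 * l M := by
        have := mul_le_mul_of_nonneg_left hM (by positivity : 0 ≤ α / 4)
        have h3 : α / 4 * (4 / α * (m N + l N : ℝ)) = m N + l N := by field_simp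
        linarith
      simp only [Nat.card_Ico, Nat.add_sub_cancel_left]
      refine le_trans ?_ h1
      linarith)
  set Q : Set ℕ := {b | ∀ᶠ c in (q : Filter ℕ), b + c ∈ A} with hQ
  have hQN : ∀ N, {c | α / 2 * l N ≤ cnt {b | b + c ∈ A} (m N) (l N)} ∈ q →
      α / 2 * l N ≤ cnt Q (m N) (l N) := by
    intro N hN
    have h1 : ∀ᶠ c in (q : Filter ℕ), ∀ b ∈ Finset.Ico (m N) (m N + l N), b ∉ Q → b + c ∉ A := by
      rw [Filter.eventually_all_finset]
      intro b _
      by_cases hb : b ∈ Q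
      · simp [hb]
      · have : ∀ᶠ c in (q : Filter ℕ), ¬ (b + c ∈ A) := Ultrafilter.eventually_not.2 hb
        filter_upwards [this] with c hc _ using hc
    obtain ⟨c, hc1, hc2⟩ := (h1.and hN).exists
    refine le_trans hc2 ?_
    unfold cnt
    norm_cast
    refine Finset.card_le_card ?_
    intro b hb
    simp only [Finset.mem_filter, Set.mem_ofPred_eq] at hb ⊢
    refine ⟨hb.1, ?_⟩
    by_contra hbQ
    exact hc1 b hb.1 hbQ hb.2
  -- a sequence converging to the first ultrafilter on `Q`
  have hcex : ∀ n : ℕ, ∃ c, n ≤ c ∧ ∀ b ∈ Finset.range n, b ∈ Q → b + c ∈ A := by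
    intro n
    have h1 : ∀ᶠ c in (q : Filter ℕ), ∀ b ∈ Finset.range n, b ∈ Q → b + c ∈ A := by
      rw [Filter.eventually_all_finset]
      intro b _
      by_cases hb : b ∈ Q
      · filter_upwards [hb] with c hc _ using hc
      · simp [hb]
    exact (((eventually_ge_atTop n).filter_mono hq).and h1).exists
  choose c hc1 hc2 using hcex
  obtain ⟨φ, hφ, hφS⟩ := extraction_of_frequently_atTop hqS
  have hF : ∀ k, α / 2 * l (φ k) ≤ cnt Q (m (φ k)) (l (φ k)) := fun k => hQN _ (hφS k)
  have hlφ : Tendsto (fun k => (l (φ k) : ℝ)) atTop atTop := hltendR.comp hφ.tendsto_atTop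
  have hFt : Tendsto (fun k => (cnt Q (m (φ k)) (l (φ k)) : ℝ)) atTop atTop :=
    tendsto_atTop_mono hF (hlφ.const_mul_atTop (by positivity))
  -- second ultrafilter
  obtain ⟨p, hp, hpS⟩ := key_ultrafilter
    (fun k => (Finset.Ico (m (φ k)) (m (φ k) + l (φ k))).filter (· ∈ Q))
    (fun k => by
      rw [← Finset.card_pos]
      have h1 := hF k
      have h2 : (0 : ℝ) < l (φ k) := by exact_mod_cast hlpos _
      have h3 : (0 : ℝ) < cnt Q (m (φ k)) (l (φ k)) := lt_of_lt_of_le (by positivity) h1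
      exact_mod_cast h3)
    (tendsto_natCast_atTop_iff.1 hFt)
    (fun j => {b | b ∈ Q ∧ c j + b ∈ thick A W}) (1 / 2) (by norm_num) (by
      intro j
      filter_upwards [hFt.eventually_ge_atTop (4 * c j)] with k hk
      have h1 := hF k
      have h2 := hl2 (φ k)
      have h3 : (cnt (thick A W) (m (φ k)) (l (φ k)) : ℝ) ≤
        cnt {b | c j + b ∈ thick A W} (m (φ k)) (l (φ k)) + c j := by
          exact_mod_cast cnt_shift _ _ _ _
      have h4 : cnt Q (m (φ k)) (l (φ k)) + cnt {b | c j + b ∈ thick A W} (m (φ k)) (l (φ k)) ≤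
          l (φ k) + (((Finset.Ico (m (φ k)) (m (φ k) + l (φ k))).filter (· ∈ Q)).filter
            (· ∈ {b | b ∈ Q ∧ c j + b ∈ thick A W})).card := by
        have hu := Finset.card_union_add_card_inter
          ((Finset.Ico (m (φ k)) (m (φ k) + l (φ k))).filter (· ∈ Q))
          ((Finset.Ico (m (φ k)) (m (φ k) + l (φ k))).filter (· ∈ {b | c j + b ∈ thick A W}))
        unfold cnt
        rw [← hu]
        refine add_le_add ?_ (Finset.card_le_card ?_)
        · rw [← Finset.filter_or]
          refine (Finset.card_filter_le _ _).trans ?_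
          simp
        · intro b hb
          simp only [Finset.mem_inter, Finset.mem_filter, Set.mem_ofPred_eq] at hb ⊢
          exact ⟨hb.1, hb.1.2, hb.2.2⟩
      have h4' : (cnt Q (m (φ k)) (l (φ k)) : ℝ) +
          cnt {b | c j + b ∈ thick A W} (m (φ k)) (l (φ k)) ≤
          l (φ k) + (((Finset.Ico (m (φ k)) (m (φ k) + l (φ k))).filter (· ∈ Q)).filter
            (· ∈ {b | b ∈ Q ∧ c j + b ∈ thick A W})).card := by exact_mod_cast h4
      have h5 : (((Finset.Ico (m (φ k)) (m (φ k) + l (φ k))).filter (· ∈ Q)).card : ℝ)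
        = cnt Q (m (φ k)) (l (φ k)) := rfl
      rw [h5]
      refine le_trans ?_ ((sub_le_iff_le_add'.2 h4').trans (le_of_eq ?_))
      · linarith
      · congr 2
        ext x
        simp only [Finset.mem_filter, Set.mem_ofPred_eq])
  have hQp : Q ∈ p := by
    obtain ⟨j, hj⟩ := hpS.exists
    exact mem_of_superset hj fun b hb => hb.1
  -- refine to a constant shift
  obtain ⟨v, hv1, hv2⟩ : ∃ v : Ultrafilter ℕ, (v : Filter ℕ) ≤ atTop ∧
      ∀ᶠ j in (v : Filter ℕ), ∀ᶠ b in (p : Filter ℕ), c j + b ∈ thick A W := by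
    have hne : (atTop ⊓ 𝓟 {j | ∀ᶠ b in (p : Filter ℕ), c j + b ∈ thick A W}).NeBot := by
      rw [← frequently_mem_iff_neBot]
      refine hpS.mono fun j hj => ?_
      exact mem_of_superset hj fun b hb => hb.2
    have hle := Ultrafilter.of_le (atTop ⊓ 𝓟 {j | ∀ᶠ b in (p : Filter ℕ), c j + b ∈ thick A W})
    refine ⟨Ultrafilter.of (atTop ⊓ 𝓟 {j | ∀ᶠ b in (p : Filter ℕ), c j + b ∈ thick A W}),
      hle.trans inf_le_left, ?_⟩
    exact (hle.trans inf_le_right) (mem_principal_self _)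
  have hfu : ∀ (u : Ultrafilter ℕ) (P : ℕ → ℤ → Prop),
      (∀ᶠ x in (u : Filter ℕ), ∃ k ∈ Set.Ioo (-(W : ℤ)) W, P x k) →
      ∃ k ∈ Set.Ioo (-(W : ℤ)) W, ∀ᶠ x in (u : Filter ℕ), P x k := by
    intro u P h
    have h1 : (⋃ k ∈ Set.Ioo (-(W : ℤ)) W, {x | P x k}) ∈ u := by
      refine mem_of_superset h fun x hx => ?_
      simpa using hx
    exact (Ultrafilter.finite_biUnion_mem_iff (Set.finite_Ioo _ _)).1 h1
  obtain ⟨k, -, hk⟩ := hfu v (fun j k => ∀ᶠ b : ℕ in (p : Filter ℕ),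
      ((b : ℤ) + (c j : ℤ)) ∈ (fun a : ℕ => (a : ℤ) + k) '' A) (by
    filter_upwards [hv2] with j hj
    refine hfu p _ ?_
    filter_upwards [hj] with b hb
    obtain ⟨a, ha, h1, h2⟩ := hb
    refine ⟨(b : ℤ) + c j - a, ⟨by omega, by omega⟩, a, ha, ?_⟩
    simp)
  refine ⟨k, ?_⟩
  have hct : Tendsto c v atTop := (tendsto_atTop_mono hc1 tendsto_id).mono_left hv1
  refine seq_of_filters p (map c v) hp hct (fun b c => b + c ∈ A)
    (fun b c => ((b : ℤ) + (c : ℤ)) ∈ (fun a : ℕ => (a : ℤ) + k) '' A) ?_ ?_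
  · filter_upwards [hQp] with b hb
    rw [eventually_map]
    filter_upwards [(eventually_gt_atTop b).filter_mono hv1] with j hj
    exact hc2 j b (Finset.mem_range.2 hj) hb
  · rw [eventually_map]
    exact hk
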